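/- Fix m_P ≠ m_Q and σ_P, σ_Q with σ_Q > 0 and 0 < s < 1, where a, v, r, s are defined as in the context. Then the binary Pearson χ² quantity satisfies d_A^{(2)}(r‖s) = (1/2)( (r−s)²/s + ((1−r)−(1−s))²/(1−s) ) = a²/(2σ_Q²). -/

import Mathlib

open MeasureTheory Real Set

/-- `v := (1/(2|a|))√((σ_Q²−σ_P²)² + 2a²(σ_P²+σ_Q²) + a⁴)` with `a = m_P − m_Q`. -/
noncomputable def vParam (mP mQ σP σQ : ℝ) : ℝ :=
  (1 / (2 * |mP - mQ|)) *
    Real.sqrt ((σQ ^ 2 - σP ^ 2) ^ 2 + 2 * (mP - mQ) ^ 2 * (σP ^ 2 + σQ ^ 2) + (mP - mQ) ^ 4)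

/-- `r := 1/2 + (σ_Q²−σ_P²+a²)/(4av)`. -/
noncomputable def rParam (mP mQ σP σQ : ℝ) : ℝ :=
  1 / 2 + (σQ ^ 2 - σP ^ 2 + (mP - mQ) ^ 2) / (4 * (mP - mQ) * vParam mP mQ σP σQ)

/-- `s := 1/2 + (σ_Q²−σ_P²−a²)/(4av)`. -/
noncomputable def sParam (mP mQ σP σQ : ℝ) : ℝ :=
  1 / 2 + (σQ ^ 2 - σP ^ 2 - (mP - mQ) ^ 2) / (4 * (mP - mQ) * vParam mP mQ σP σQ)

/-- The binary `χ²` divergence written with differences of the two distributions. -/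
theorem binary_chi_square_eq_sub_sq {r s : ℝ} (hs : s ≠ 0) (hs' : 1 - s ≠ 0) :
    r ^ 2 / s + (1 - r) ^ 2 / (1 - s) - 1
      = (r - s) ^ 2 / s + ((1 - r) - (1 - s)) ^ 2 / (1 - s) := by
  field_simp
  ring

/-- The binary `χ²` divergence as a single fraction. -/
theorem binary_chi_square_eq_div {r s : ℝ} (hs : s ≠ 0) (hs' : 1 - s ≠ 0) :
    r ^ 2 / s + (1 - r) ^ 2 / (1 - s) - 1 = (r - s) ^ 2 / (s * (1 - s)) := by
  field_simp
  ring

theorem vParam_sq (mP mQ σP σQ : ℝ) :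
    vParam mP mQ σP σQ ^ 2 = ((σQ ^ 2 - σP ^ 2) ^ 2 + 2 * (mP - mQ) ^ 2 * (σP ^ 2 + σQ ^ 2)
      + (mP - mQ) ^ 4) / (4 * (mP - mQ) ^ 2) := by
  rw [vParam, mul_pow, Real.sq_sqrt (by positivity), div_pow, mul_pow, sq_abs]
  ring

theorem vParam_pos {mP mQ : ℝ} (σP σQ : ℝ) (hm : mP ≠ mQ) : 0 < vParam mP mQ σP σQ := by
  have ha : mP - mQ ≠ 0 := sub_ne_zero.mpr hm
  unfold vParam
  positivity

theorem rParam_sub_sParam {mP mQ : ℝ} (σP σQ : ℝ) (hm : mP ≠ mQ) :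
    rParam mP mQ σP σQ - sParam mP mQ σP σQ = (mP - mQ) / (2 * vParam mP mQ σP σQ) := by
  have ha : mP - mQ ≠ 0 := sub_ne_zero.mpr hm
  have hv := (vParam_pos σP σQ hm).ne'
  unfold rParam sParam
  field_simp
  ring

theorem sParam_mul_one_sub {mP mQ : ℝ} (σP σQ : ℝ) (hm : mP ≠ mQ) :
    sParam mP mQ σP σQ * (1 - sParam mP mQ σP σQ)
      = σQ ^ 2 / (4 * vParam mP mQ σP σQ ^ 2) := by
  have ha : mP - mQ ≠ 0 := sub_ne_zero.mpr hm
  have hv := (vParam_pos σP σQ hm).ne'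
  have hsq := vParam_sq mP mQ σP σQ
  rw [eq_div_iff (by positivity)] at hsq
  unfold sParam
  generalize vParam mP mQ σP σQ = v at *
  generalize mP - mQ = a at *
  field_simp
  linear_combination 4 * hsq

/-- The binary Pearson χ² quantity: with `m_P ≠ m_Q`, `σ_Q > 0` and
`0 < s < 1`, `d_A^{(2)}(r‖s) = (1/2)((r−s)²/s + ((1−r)−(1−s))²/(1−s))
= a²/(2σ_Q²)` where `a = m_P − m_Q`. -/
theorem binary_chi_square_formula
    (mP mQ σP σQ : ℝ) (hm : mP ≠ mQ) (hσP : 0 ≤ σP) (hσQ : 0 < σQ)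
    (hs0 : 0 < sParam mP mQ σP σQ) (hs1 : sParam mP mQ σP σQ < 1) :
    (1 / 2) * (rParam mP mQ σP σQ ^ 2 / sParam mP mQ σP σQ
        + (1 - rParam mP mQ σP σQ) ^ 2 / (1 - sParam mP mQ σP σQ) - 1)
      = (1 / 2) * ((rParam mP mQ σP σQ - sParam mP mQ σP σQ) ^ 2 / sParam mP mQ σP σQ
        + ((1 - rParam mP mQ σP σQ) - (1 - sParam mP mQ σP σQ)) ^ 2
            / (1 - sParam mP mQ σP σQ))
    ∧ (1 / 2) * (rParam mP mQ σP σQ ^ 2 / sParam mP mQ σP σQ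
        + (1 - rParam mP mQ σP σQ) ^ 2 / (1 - sParam mP mQ σP σQ) - 1)
      = (mP - mQ) ^ 2 / (2 * σQ ^ 2) := by
  have hs : sParam mP mQ σP σQ ≠ 0 := hs0.ne'
  have hs' : 1 - sParam mP mQ σP σQ ≠ 0 := (sub_pos.mpr hs1).ne'
  have hv := (vParam_pos σP σQ hm).ne'
  refine ⟨by rw [binary_chi_square_eq_sub_sq hs hs'], ?_⟩
  rw [binary_chi_square_eq_div hs hs', rParam_sub_sParam σP σQ hm, sParam_mul_one_sub σP σQ hm]
  field_simp
  norm_num
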